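/- arXiv:math/0603231 — 2 statements merged into one kernel-verified Lean document; each statement's English description precedes it below -/
import Mathlib

section
/- Assume n ≥ 3, r ≥ 2, and let G = G(r,r,n) and g = ξ_1^{ℓ} ξ_2^{−ℓ} with ℓ ≢ 0 (mod r) and 2ℓ ≢ 0 (mod r) (i.e., ℓ ≠ r/2). Set n' = n−2, f_{n'} = v_3⋯v_n, and f_i = e_i(v_3^r,…,v_n^r) for 1 ≤ i ≤ n'−1. Then S(V^g)^{Z(g)} = ℂ[f_1,…,f_{n'−1}, f_{n'}^r]. -/
open MvPolynomial Matrix Finset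

attribute [local instance] Classical.propDecidable

noncomputable section

/-- The group `G(r,p,n)` of monomial `n×n` matrices whose nonzero entries are `r`-th roots
of unity and such that the product of the nonzero entries raised to the `r/p` power is `1`.
(For a monomial matrix the product of the nonzero entries is `∏ i, ∑ j, M i j`.) -/
def GG (r p n : ℕ) : Set (Matrix (Fin n) (Fin n) ℂ) :=
  {M | (∃ (σ : Equiv.Perm (Fin n)) (d : Fin n → ℂ),
          (∀ j, d j ^ r = 1) ∧ ∀ i j, M i j = if i = σ j then d j else 0) ∧
       (∏ i, ∑ j, M i j) ^ (r / p) = 1}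

/-- The centralizer of `g` in `G(r,p,n)`. -/
def Zg (r p n : ℕ) (g : Matrix (Fin n) (Fin n) ℂ) : Set (Matrix (Fin n) (Fin n) ℂ) :=
  {h | h ∈ GG r p n ∧ h * g = g * h}

/-- The action of a matrix `M` on `S(V) = ℂ[v_1,…,v_n]`, sending the variable `X j`
(the `j`-th basis vector of `V`) to the linear form corresponding to `M · e_j`. -/
def act {n : ℕ} (M : Matrix (Fin n) (Fin n) ℂ) :
    MvPolynomial (Fin n) ℂ →ₐ[ℂ] MvPolynomial (Fin n) ℂ :=
  aeval fun j => ∑ i, C (M i j) * X i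

/-- `S(V^g)`: the subalgebra of `S(V)` generated by the linear forms corresponding to
vectors fixed by `g`. -/
def SVg {n : ℕ} (g : Matrix (Fin n) (Fin n) ℂ) : Subalgebra ℂ (MvPolynomial (Fin n) ℂ) :=
  Algebra.adjoin ℂ {q | ∃ c : Fin n → ℂ, g.mulVec c = c ∧ q = ∑ i, C (c i) * X i}

/-- The fixed space `V^g` inside Euclidean space `ℂⁿ`. -/
def fixedSpace {n : ℕ} (M : Matrix (Fin n) (Fin n) ℂ) :
    Submodule ℂ (EuclideanSpace ℂ (Fin n)) :=
  LinearMap.ker (Matrix.toEuclideanLin M - LinearMap.id)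

/-- The determinant of the restriction of an endomorphism to an invariant subspace
(junk value `0` if the subspace is not invariant). -/
def detOn {n : ℕ} (f : EuclideanSpace ℂ (Fin n) →ₗ[ℂ] EuclideanSpace ℂ (Fin n))
    (W : Submodule ℂ (EuclideanSpace ℂ (Fin n))) : ℂ :=
  if h : ∀ x ∈ W, f x ∈ W then LinearMap.det (f.restrict h) else 0

/-- The Hochschild character `χ_g(h) = det(h^⊥)`: the determinant of `h` restricted to the
orthogonal complement of the fixed space `V^g`. -/
def chi {n : ℕ} (g h : Matrix (Fin n) (Fin n) ℂ) : ℂ :=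
  detOn (Matrix.toEuclideanLin h) (fixedSpace g)ᗮ

/-- The diagonal element `g = ξ₁^ℓ ξ₂^{−ℓ}` of `G(r,r,n)`. -/
def gdiag (n : ℕ) [NeZero n] (ξ : ℂ) (ℓ : ℕ) : Matrix (Fin n) (Fin n) ℂ :=
  Matrix.diagonal fun t : Fin n => if t = 0 then ξ ^ ℓ else if t = 1 then (ξ ^ ℓ)⁻¹ else 1

/-- `f_i`: the `i`-th elementary symmetric polynomial in `v₃^r, …, v_n^r`. -/
def fmid (r n : ℕ) (i : ℕ) : MvPolynomial (Fin n) ℂ :=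
  ∑ s ∈ Finset.powersetCard i (Finset.univ.filter fun t : Fin n => 2 ≤ (t : ℕ)),
    ∏ t ∈ s, X t ^ r

/-- `f_{n'} = v₃ ⋯ v_n`. -/
def flast (n : ℕ) : MvPolynomial (Fin n) ℂ :=
  ∏ t ∈ Finset.univ.filter fun t : Fin n => 2 ≤ (t : ℕ), X t

namespace MvPolynomial

variable {σ R : Type*}

/-- Rescaling the variables multiplies each coefficient by the corresponding monomial value. -/
lemma coeff_aeval_C_mul_X [CommSemiring R] (c : σ → R) (p : MvPolynomial σ R) (m : σ →₀ ℕ) :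
    coeff m (aeval (fun s => C (c s) * X s) p) = (m.prod fun s k => c s ^ k) * coeff m p := by
  induction p using MvPolynomial.induction_on' with
  | monomial u a =>
    have h : aeval (fun s => C (c s) * X s) (monomial u a)
        = C (u.prod fun s k => c s ^ k) * monomial u a := by
      rw [aeval_monomial, monomial_eq]
      simp only [mul_pow, algebraMap_eq, Finsupp.prod, map_prod, map_pow, Finset.prod_mul_distrib]
      ring
    rw [h, coeff_C_mul, coeff_monomial]
    split_ifs with hm
    · rw [hm]
    · simp
  | add p q hp hq => simp only [map_add, coeff_add, hp, hq, mul_add]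

/-- A polynomial all of whose exponents are divisible by `r` is in the image of `expand r`. -/
lemma exists_expand_eq [CommSemiring R] (r : ℕ) (p : MvPolynomial σ R)
    (hp : ∀ m ∈ p.support, ∀ s, r ∣ m s) : ∃ q, expand r q = p := by
  suffices h : p ∈ (expand r : MvPolynomial σ R →ₐ[R] MvPolynomial σ R).range from h
  rw [p.as_sum]
  refine Subalgebra.sum_mem _ fun m hm => ⟨monomial (m.mapRange (· / r) (Nat.zero_div r))
    (coeff m p), ?_⟩
  refine (expand_monomial r _ _).trans (congrArg (fun d => monomial d (coeff m p)) ?_)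
  ext s
  simpa using Nat.mul_div_cancel' (hp m hm s)

/-- Every symmetric polynomial is a polynomial in the elementary symmetric polynomials. -/
lemma symmetricSubalgebra_eq_adjoin_esymm (σ R : Type*) [Fintype σ] [CommRing R] :
    symmetricSubalgebra σ R
      = Algebra.adjoin R (esymm σ R '' Set.Icc 1 (Fintype.card σ)) := by
  apply le_antisymm
  · intro p hp
    obtain ⟨x, hx⟩ := esymmAlgHom_surjective (σ := σ) R le_rfl ⟨p, hp⟩
    have hx' := congrArg Subtype.val hx
    rw [esymmAlgHom_apply] at hx'
    simp only at hx'
    rw [← hx']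
    refine Algebra.adjoin_mono ?_ ((Algebra.adjoin_range_eq_range_aeval R _).ge ⟨x, rfl⟩)
    rintro _ ⟨i, rfl⟩
    exact ⟨i + 1, ⟨by omega, i.2⟩, rfl⟩
  · rw [Algebra.adjoin_le_iff]
    rintro _ ⟨i, -, rfl⟩
    exact esymm_isSymmetric σ R i

end MvPolynomial

/-- The monomial matrix with entry `d j` at position `(σ j, j)`. -/
def monomialMatrix {n : ℕ} (σ : Equiv.Perm (Fin n)) (d : Fin n → ℂ) :
    Matrix (Fin n) (Fin n) ℂ :=
  Matrix.of fun i j => if i = σ j then d j else 0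

lemma act_monomialMatrix_X {n : ℕ} (σ : Equiv.Perm (Fin n)) (d : Fin n → ℂ) (j : Fin n) :
    act (monomialMatrix σ d) (X j) = C (d j) * X (σ j) := by
  simp [act, monomialMatrix, apply_ite C, ite_mul]

lemma monomialMatrix_mem_GG {r n : ℕ} {σ : Equiv.Perm (Fin n)} {d : Fin n → ℂ}
    (hd : ∀ j, d j ^ r = 1) (hprod : ∏ j, d j = 1) : monomialMatrix σ d ∈ GG r r n := by
  refine ⟨⟨σ, d, hd, fun i j => rfl⟩, ?_⟩
  have h : ∀ i, ∑ j, monomialMatrix σ d i j = d (σ.symm i) := fun i => by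
    simp [monomialMatrix, ← Equiv.symm_apply_eq]
  simp only [h]
  rw [Equiv.prod_comp σ.symm d, hprod, one_pow]

lemma monomialMatrix_mul_diagonal {n : ℕ} (σ : Equiv.Perm (Fin n)) (d g : Fin n → ℂ)
    (hσ : ∀ j, g (σ j) = g j) :
    monomialMatrix σ d * Matrix.diagonal g = Matrix.diagonal g * monomialMatrix σ d := by
  ext i j
  rw [Matrix.mul_diagonal, Matrix.diagonal_mul]
  simp only [monomialMatrix, Matrix.of_apply]
  split_ifs with h
  · rw [h, hσ, mul_comm]
  · simp

/-- A monomial matrix commuting with a diagonal matrix permutes indices within its eigenspaces. -/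
lemma apply_perm_of_monomialMatrix_commute {n : ℕ} {σ : Equiv.Perm (Fin n)} {d g : Fin n → ℂ}
    (hd : ∀ j, d j ≠ 0)
    (h : monomialMatrix σ d * Matrix.diagonal g = Matrix.diagonal g * monomialMatrix σ d)
    (j : Fin n) : g (σ j) = g j := by
  have h' := congrFun (congrFun h (σ j)) j
  rw [Matrix.mul_diagonal, Matrix.diagonal_mul] at h'
  simp only [monomialMatrix, Matrix.of_apply, if_true] at h'
  exact (mul_left_cancel₀ (hd j) (h'.trans (mul_comm _ _))).symm

/-- The diagonal entries of `gdiag n ξ ℓ`. -/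
def gdiagEntry (n : ℕ) [NeZero n] (ξ : ℂ) (ℓ : ℕ) (t : Fin n) : ℂ :=
  if t = 0 then ξ ^ ℓ else if t = 1 then (ξ ^ ℓ)⁻¹ else 1

lemma gdiag_eq_diagonal (n : ℕ) [NeZero n] (ξ : ℂ) (ℓ : ℕ) :
    gdiag n ξ ℓ = Matrix.diagonal (gdiagEntry n ξ ℓ) := rfl

lemma gdiagEntry_of_two_le {n : ℕ} [NeZero n] (ξ : ℂ) (ℓ : ℕ) {t : Fin n} (ht : 2 ≤ (t : ℕ)) :
    gdiagEntry n ξ ℓ t = 1 := by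
  have h0 : t ≠ 0 := by rintro rfl; simp at ht
  have h1 : t ≠ 1 := by
    rintro rfl
    rw [Fin.val_one'] at ht
    exact absurd (ht.trans (Nat.mod_le 1 n)) (by norm_num)
  simp [gdiagEntry, h0, h1]

lemma gdiagEntry_eq_one_iff {n : ℕ} [NeZero n] (hn : 3 ≤ n) {ξ : ℂ} {ℓ : ℕ} (h : ξ ^ ℓ ≠ 1)
    (t : Fin n) : gdiagEntry n ξ ℓ t = 1 ↔ 2 ≤ (t : ℕ) := by
  refine ⟨fun ht => ?_, gdiagEntry_of_two_le ξ ℓ⟩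
  by_contra hlt
  unfold gdiagEntry at ht
  split_ifs at ht with h0 h1
  · exact h ht
  · exact h (inv_eq_one.mp ht)
  · rw [Fin.ext_iff, Fin.val_zero] at h0
    rw [Fin.ext_iff, Fin.val_one', Nat.mod_eq_of_lt (by omega)] at h1
    omega

/-- The fixed subalgebra of a diagonal matrix is generated by the variables with eigenvalue `1`. -/
lemma SVg_diagonal {n : ℕ} (g : Fin n → ℂ) :
    SVg (Matrix.diagonal g) = supported ℂ {t | g t = 1} := by
  apply le_antisymm
  · refine Algebra.adjoin_le ?_
    rintro _ ⟨c, hc, rfl⟩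
    refine Subalgebra.sum_mem _ fun i _ => ?_
    by_cases hi : g i = 1
    · exact Subalgebra.mul_mem _ (Subalgebra.algebraMap_mem _ (c i)) (X_mem_supported.mpr hi)
    · have hci : c i = 0 := by
        have h := congrFun hc i
        rw [Matrix.mulVec_diagonal] at h
        by_contra h0
        exact hi (mul_right_cancel₀ h0 (h.trans (one_mul _).symm))
      simp [hci]
  · refine Algebra.adjoin_le ?_
    rintro _ ⟨t, ht, rfl⟩
    refine Algebra.subset_adjoin ⟨Pi.single t 1, ?_, ?_⟩
    · ext i
      rw [Matrix.mulVec_diagonal]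
      by_cases hi : i = t
      · subst hi
        rw [show g i = 1 from ht, one_mul]
      · simp [hi]
    · simp [Pi.single_apply, apply_ite C, ite_mul]

/-- The embedding of the polynomials in the variables `v₃, …, v_n` substituting `v_t ^ r`
for `v_t`. -/
def powEmbedding (r n : ℕ) :
    MvPolynomial {t : Fin n // 2 ≤ (t : ℕ)} ℂ →ₐ[ℂ] MvPolynomial (Fin n) ℂ :=
  (rename Subtype.val).comp (expand r)

lemma powEmbedding_X (r n : ℕ) (t : {t : Fin n // 2 ≤ (t : ℕ)}) :
    powEmbedding r n (X t) = X t.1 ^ r := by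
  simp [powEmbedding]

lemma powEmbedding_esymm (r n i : ℕ) :
    powEmbedding r n (esymm _ ℂ i) = fmid r n i := by
  have h : (Finset.univ.filter fun t : Fin n => 2 ≤ (t : ℕ))
      = Finset.univ.map (Function.Embedding.subtype fun t : Fin n => 2 ≤ (t : ℕ)) := by
    ext t
    simp
  simp only [fmid, h, Finset.powersetCard_map, esymm, map_sum, map_prod, powEmbedding_X,
    Finset.sum_map, RelEmbedding.coe_toEmbedding, Finset.mapEmbedding_apply, Finset.prod_map,
    Function.Embedding.subtype_apply]

lemma card_two_le {n : ℕ} : (Finset.univ.filter fun t : Fin n => 2 ≤ (t : ℕ)).card = n - 2 := by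
  rw [← Finset.card_map Fin.valEmbedding]
  have h : (Finset.univ.filter fun t : Fin n => 2 ≤ (t : ℕ)).map Fin.valEmbedding
      = Finset.Ico 2 n := by
    ext k
    simp only [Finset.mem_map, Finset.mem_filter, Finset.mem_univ, true_and,
      Fin.valEmbedding_apply, Finset.mem_Ico]
    exact ⟨by rintro ⟨t, ht, rfl⟩; exact ⟨ht, t.2⟩, fun hk => ⟨⟨k, hk.2⟩, hk.1, rfl⟩⟩
  rw [h, Nat.card_Ico]

lemma flast_pow_eq_fmid (r n : ℕ) : flast n ^ r = fmid r n (n - 2) := by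
  rw [fmid, ← card_two_le, Finset.powersetCard_self, Finset.sum_singleton, flast,
    Finset.prod_pow]

lemma adjoin_eq_map_symmetricSubalgebra {r n : ℕ} (hn : 3 ≤ n) :
    Algebra.adjoin ℂ (insert (flast n ^ r) ((fun i => fmid r n i) '' Set.Ico 1 (n - 2)))
      = (symmetricSubalgebra {t : Fin n // 2 ≤ (t : ℕ)} ℂ).map (powEmbedding r n) := by
  have hcard : Fintype.card {t : Fin n // 2 ≤ (t : ℕ)} = n - 2 := by
    rw [Fintype.card_subtype, card_two_le]
  rw [symmetricSubalgebra_eq_adjoin_esymm, AlgHom.map_adjoin, Set.image_image, hcard,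
    ← Set.Ico_insert_right (by omega), Set.image_insert_eq]
  simp only [powEmbedding_esymm, flast_pow_eq_fmid]

/-- Monomial matrices preserving the set of indices `t` with `2 ≤ t` act on the image of
`powEmbedding r n` by permuting variables. -/
lemma act_monomialMatrix_powEmbedding {r n : ℕ} {σ : Equiv.Perm (Fin n)} {d : Fin n → ℂ}
    (hd : ∀ j, d j ^ r = 1) (hσ : ∀ t : Fin n, 2 ≤ (t : ℕ) ↔ 2 ≤ (σ t : ℕ))
    (q : MvPolynomial {t : Fin n // 2 ≤ (t : ℕ)} ℂ) :
    act (monomialMatrix σ d) (powEmbedding r n q)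
      = powEmbedding r n (rename (σ.subtypePerm fun t => (hσ t).symm) q) := by
  rw [← AlgHom.comp_apply, ← AlgHom.comp_apply]
  congr 1
  ext1 t
  simp [powEmbedding_X, act_monomialMatrix_X, mul_pow, ← C_pow, hd]

/-- Invariance under the diagonal matrices `ξ_t ξ_1⁻¹` forces all exponents to be divisible
by `r`. -/
lemma dvd_of_act_invariant {r n : ℕ} [NeZero n] {ξ : ℂ} {ℓ : ℕ} (hξ : IsPrimitiveRoot ξ r)
    {p : MvPolynomial {t : Fin n // 2 ≤ (t : ℕ)} ℂ} (hr : r ≠ 0)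
    (hinv : ∀ h ∈ Zg r r n (gdiag n ξ ℓ), act h (rename Subtype.val p) = rename Subtype.val p)
    {m : {t : Fin n // 2 ≤ (t : ℕ)} →₀ ℕ} (hm : m ∈ p.support)
    (t : {t : Fin n // 2 ≤ (t : ℕ)}) : r ∣ m t := by
  have hξ0 : ξ ≠ 0 := hξ.ne_zero hr
  set d : Fin n → ℂ := fun j => (if j = t.1 then ξ else 1) * (if j = 0 then ξ⁻¹ else 1) with hd
  have hmem : monomialMatrix 1 d ∈ Zg r r n (gdiag n ξ ℓ) := by
    refine ⟨monomialMatrix_mem_GG (fun j => ?_) ?_, monomialMatrix_mul_diagonal _ _ _ fun j => rfl⟩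
    · simp only [hd, mul_pow]
      split_ifs <;> simp [hξ.pow_eq_one]
    · simp only [hd, Finset.prod_mul_distrib, Finset.prod_ite_eq', Finset.mem_univ, if_true]
      exact mul_inv_cancel₀ hξ0
  have hact : act (monomialMatrix 1 d) (rename Subtype.val p)
      = rename Subtype.val (aeval (fun s => C (if s = t then ξ else 1) * X s) p) := by
    rw [← AlgHom.comp_apply, ← AlgHom.comp_apply]
    congr 1
    ext1 s
    have hs : s.1 ≠ 0 := fun h => by
      have := s.2
      rw [h] at this
      simp at this
    simp [act_monomialMatrix_X, hd, hs, Subtype.ext_iff]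
  have hfix := rename_injective _ Subtype.val_injective (hact.symm.trans (hinv _ hmem))
  have hcoeff := congrArg (coeff m) hfix
  rw [coeff_aeval_C_mul_X] at hcoeff
  have hone := mul_right_cancel₀ (mem_support_iff.mp hm) (hcoeff.trans (one_mul _).symm)
  rw [Finsupp.prod_fintype _ _ (fun _ => pow_zero _)] at hone
  simp only [ite_pow, one_pow, Finset.prod_ite_eq', Finset.mem_univ, if_true] at hone
  exact (hξ.pow_eq_one_iff_dvd _).mp hone

/-- Invariance under the permutations of `v₃, …, v_n` forces symmetry. -/
lemma isSymmetric_of_act_invariant {r n : ℕ} [NeZero n] {ξ : ℂ} {ℓ : ℕ} (hr : 0 < r)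
    {q : MvPolynomial {t : Fin n // 2 ≤ (t : ℕ)} ℂ}
    (hinv : ∀ h ∈ Zg r r n (gdiag n ξ ℓ), act h (powEmbedding r n q) = powEmbedding r n q) :
    q.IsSymmetric := by
  intro e
  have hmem : ∀ t : Fin n, 2 ≤ (t : ℕ) ↔ 2 ≤ (Equiv.Perm.ofSubtype e t : ℕ) := fun t =>
    (Equiv.Perm.ofSubtype_apply_mem_iff_mem e t).symm
  have hZ : monomialMatrix (Equiv.Perm.ofSubtype e) 1 ∈ Zg r r n (gdiag n ξ ℓ) := by
    refine ⟨monomialMatrix_mem_GG (by simp) (by simp), monomialMatrix_mul_diagonal _ _ _ fun j => ?_⟩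
    change gdiagEntry n ξ ℓ _ = gdiagEntry n ξ ℓ j
    by_cases hj : 2 ≤ (j : ℕ)
    · rw [gdiagEntry_of_two_le ξ ℓ hj, gdiagEntry_of_two_le ξ ℓ ((hmem j).mp hj)]
    · rw [Equiv.Perm.ofSubtype_apply_of_not_mem e hj]
  have h := hinv _ hZ
  rw [act_monomialMatrix_powEmbedding (by simp) hmem] at h
  have hinj : Function.Injective (powEmbedding r n) :=
    (rename_injective _ Subtype.val_injective).comp (expand_injective hr)
  have he : (Equiv.Perm.ofSubtype e).subtypePerm (fun t => (hmem t).symm) = e :=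
    Equiv.Perm.subtypePerm_ofSubtype e
  rw [he] at h
  exact hinj h

/-- Assume `n ≥ 3`, `r ≥ 2`, and let `G = G(r,r,n)` and
`g = ξ₁^ℓ ξ₂^{−ℓ}` with `ℓ ≢ 0 (mod r)` and `2ℓ ≢ 0 (mod r)`.  With `n' = n−2`,
`f_{n'} = v₃⋯v_n` and `f_i = e_i(v₃^r,…,v_n^r)` for `1 ≤ i ≤ n'−1`, the invariant ring is
`S(V^g)^{Z(g)} = ℂ[f₁,…,f_{n'−1}, f_{n'}^r]`. -/
theorem invariants_of_diagonal_in_Grrn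
    (r n : ℕ) [NeZero n] (hn : 3 ≤ n) (hr : 2 ≤ r)
    (ξ : ℂ) (hξ : IsPrimitiveRoot ξ r)
    (ℓ : ℕ) (h1 : ¬ r ∣ ℓ) (h2 : ¬ r ∣ 2 * ℓ) :
    {f : MvPolynomial (Fin n) ℂ |
        f ∈ SVg (gdiag n ξ ℓ) ∧ ∀ h ∈ Zg r r n (gdiag n ξ ℓ), act h f = f}
      = ↑(Algebra.adjoin ℂ
          (insert (flast n ^ r) ((fun i => fmid r n i) '' Set.Ico 1 (n - 2)))) := by
  have hξℓ : ξ ^ ℓ ≠ 1 := fun h => h1 ((hξ.pow_eq_one_iff_dvd ℓ).mp h)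
  have hfix : {t : Fin n | gdiagEntry n ξ ℓ t = 1} = {t : Fin n | 2 ≤ (t : ℕ)} :=
    Set.ext (gdiagEntry_eq_one_iff hn hξℓ)
  have hSV : SVg (gdiag n ξ ℓ)
      = (rename (R := ℂ) (Subtype.val : {t : Fin n // 2 ≤ (t : ℕ)} → Fin n)).range := by
    rw [gdiag_eq_diagonal, SVg_diagonal, hfix]
    exact supported_eq_range_rename _
  rw [adjoin_eq_map_symmetricSubalgebra hn, hSV]
  apply Set.Subset.antisymm
  · rintro _ ⟨⟨p, rfl⟩, hinv⟩
    obtain ⟨q, rfl⟩ := exists_expand_eq r p fun m hm t =>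
      dvd_of_act_invariant hξ (by omega) hinv hm t
    exact ⟨q, isSymmetric_of_act_invariant (by omega) hinv, rfl⟩
  · rintro _ ⟨q, hq, rfl⟩
    refine ⟨⟨expand r q, rfl⟩, ?_⟩
    rintro h ⟨⟨⟨σ, d, hd, hσd⟩, -⟩, hcomm⟩
    obtain rfl : h = monomialMatrix σ d := Matrix.ext hσd
    have hd0 : ∀ j, d j ≠ 0 := fun j h0 => by
      have := hd j
      rw [h0, zero_pow (by omega)] at this
      exact zero_ne_one this
    have hσ : ∀ t : Fin n, 2 ≤ (t : ℕ) ↔ 2 ≤ (σ t : ℕ) := fun t => by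
      rw [← gdiagEntry_eq_one_iff hn hξℓ, ← gdiagEntry_eq_one_iff hn hξℓ,
        apply_perm_of_monomialMatrix_commute (g := gdiagEntry n ξ ℓ) hd0 hcomm t]
    exact (act_monomialMatrix_powEmbedding hd hσ q).trans (congrArg _ (hq _))

end
end

section
/- Let G = 𝔖_n = G(1,1,n) (the group of n×n permutation matrices) act on V = ℂ^n by permuting the standard basis v_1,…,v_n, with n ≥ 4, and let g = (1,2,3). Then the χ_g-semi-invariants equal the Z(g)-invariants and S(V^g)^{χ_g} = S(V^g)^{Z(g)} = ℂ[f_0, f_1, …, f_{n−3}], where f_0 = v_1+v_2+v_3 and f_i = e_i(v_4,…,v_n) for 1 ≤ i ≤ n−3. -/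
open MvPolynomial Matrix Finset

attribute [local instance] Classical.propDecidable

noncomputable section

/-- The permutation matrix of the 3-cycle `(1,2,3)` (sending `v₁ ↦ v₂ ↦ v₃ ↦ v₁`). -/
def g123 (n : ℕ) [NeZero n] : Matrix (Fin n) (Fin n) ℂ :=
  Matrix.of fun i j : Fin n =>
    if i = ((Equiv.swap (0 : Fin n) 1).trans (Equiv.swap (0 : Fin n) 2)) j then 1 else 0

/-- The permutation matrix of `σ`. -/
def permMat {n : ℕ} (σ : Equiv.Perm (Fin n)) : Matrix (Fin n) (Fin n) ℂ :=
  Matrix.of fun i j => if i = σ j then 1 else 0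

/-- The 3-cycle on the first three indices. -/
def cyc (n : ℕ) [NeZero n] : Equiv.Perm (Fin n) :=
  (Equiv.swap (0 : Fin n) 1).trans (Equiv.swap (0 : Fin n) 2)

theorem g123_eq_permMat (n : ℕ) [NeZero n] : g123 n = permMat (cyc n) := rfl

theorem permMat_mulVec {n : ℕ} (σ : Equiv.Perm (Fin n)) (x : Fin n → ℂ) (i : Fin n) :
    (permMat σ).mulVec x i = x (σ.symm i) := by
  simp only [permMat, Matrix.mulVec, dotProduct, Matrix.of_apply]
  rw [Finset.sum_eq_single (σ.symm i)]
  · simp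
  · intro j _ hj
    rw [if_neg, zero_mul]
    rintro rfl
    simp at hj
  · simp

theorem permMat_mul {n : ℕ} (σ τ : Equiv.Perm (Fin n)) :
    permMat σ * permMat τ = permMat (σ * τ) := by
  ext i j
  simp [permMat, Matrix.mul_apply]
  congr

theorem permMat_injective {n : ℕ} : Function.Injective (permMat (n := n)) := by
  intro σ τ h
  ext j
  have := congrFun (congrFun h (σ j)) j
  simp only [permMat, Matrix.of_apply, if_true] at this
  by_contra hne
  rw [if_neg fun h => hne (congrArg _ h)] at this
  exact one_ne_zero this

theorem mem_Zg_iff {n : ℕ} (τ : Equiv.Perm (Fin n)) (h : Matrix (Fin n) (Fin n) ℂ) :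
    h ∈ Zg 1 1 n (permMat τ) ↔ ∃ σ : Equiv.Perm (Fin n), σ * τ = τ * σ ∧ h = permMat σ := by
  constructor
  · rintro ⟨⟨⟨σ, d, hd, hM⟩, -⟩, hc⟩
    have hh : h = permMat σ := by
      ext i j
      rw [hM, show d j = 1 by simpa using hd j]
      rfl
    refine ⟨σ, permMat_injective ?_, hh⟩
    rw [← permMat_mul, ← permMat_mul, ← hh, hc]
  · rintro ⟨σ, hσ, rfl⟩
    refine ⟨⟨⟨σ, fun _ => 1, by simp, fun i j => rfl⟩, ?_⟩, ?_⟩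
    · have : ∀ i, ∑ j, permMat σ i j = 1 := fun i => by
        simpa [Matrix.mulVec, dotProduct] using permMat_mulVec σ (fun _ => 1) i
      simp [this]
    · rw [permMat_mul, permMat_mul, hσ]

theorem act_permMat_X {n : ℕ} (σ : Equiv.Perm (Fin n)) (j : Fin n) :
    act (permMat σ) (X j) = X (σ j) := by
  simp [act, permMat, ite_mul]

section ThreeCycle

variable {n : ℕ} [NeZero n]

theorem val_zero_one_two (hn : 4 ≤ n) :
    ((0 : Fin n) : ℕ) = 0 ∧ ((1 : Fin n) : ℕ) = 1 ∧ ((2 : Fin n) : ℕ) = 2 :=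
  ⟨rfl, Nat.mod_eq_of_lt (show 1 < n by omega), Nat.mod_eq_of_lt (show 2 < n by omega)⟩

theorem zero_one_two_ne (hn : 4 ≤ n) :
    (0 : Fin n) ≠ 1 ∧ (0 : Fin n) ≠ 2 ∧ (1 : Fin n) ≠ 2 := by
  obtain ⟨h0, h1, h2⟩ := val_zero_one_two hn
  simp only [ne_eq, Fin.ext_iff, h0, h1, h2]
  omega

theorem fin_cases_three (hn : 4 ≤ n) (i : Fin n) : i = 0 ∨ i = 1 ∨ i = 2 ∨ 3 ≤ (i : ℕ) := by
  obtain ⟨h0, h1, h2⟩ := val_zero_one_two hn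
  simp only [Fin.ext_iff, h0, h1, h2]
  omega

theorem cyc_zero (hn : 4 ≤ n) : cyc n 0 = 1 := by
  obtain ⟨h01, h02, h12⟩ := zero_one_two_ne hn
  simp [cyc, Equiv.swap_apply_of_ne_of_ne h01.symm h12]

theorem cyc_one : cyc n 1 = 2 := by
  simp [cyc]

theorem cyc_two (hn : 4 ≤ n) : cyc n 2 = 0 := by
  obtain ⟨h01, h02, h12⟩ := zero_one_two_ne hn
  simp [cyc, Equiv.swap_apply_of_ne_of_ne h02.symm h12.symm]

theorem ne_of_three_le (hn : 4 ≤ n) {i : Fin n} (hi : 3 ≤ (i : ℕ)) : i ≠ 0 ∧ i ≠ 1 ∧ i ≠ 2 := by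
  obtain ⟨h0, h1, h2⟩ := val_zero_one_two hn
  simp only [ne_eq, Fin.ext_iff, h0, h1, h2]
  omega

theorem cyc_of_three_le (hn : 4 ≤ n) {i : Fin n} (hi : 3 ≤ (i : ℕ)) : cyc n i = i := by
  obtain ⟨h0, h1, h2⟩ := ne_of_three_le hn hi
  simp [cyc, Equiv.swap_apply_of_ne_of_ne h0 h1, Equiv.swap_apply_of_ne_of_ne h0 h2]

theorem three_le_of_cyc_eq (hn : 4 ≤ n) {i : Fin n} (hi : cyc n i = i) : 3 ≤ (i : ℕ) := by
  obtain ⟨h01, h02, h12⟩ := zero_one_two_ne hn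
  rcases fin_cases_three hn i with rfl | rfl | rfl | h
  · exact absurd ((cyc_zero hn).symm.trans hi) h01.symm
  · exact absurd ((cyc_one).symm.trans hi) h12.symm
  · exact absurd ((cyc_two hn).symm.trans hi) h02
  · exact h

theorem sum_fin_eq_three_add {M : Type*} [AddCommMonoid M] (hn : 4 ≤ n) (F : Fin n → M) :
    ∑ i, F i = F 0 + F 1 + F 2 + ∑ i ∈ univ.filter (fun t : Fin n => 3 ≤ (t : ℕ)), F i := by
  obtain ⟨h01, h02, h12⟩ := zero_one_two_ne hn
  rw [← Finset.sum_filter_not_add_sum_filter univ (fun t : Fin n => 3 ≤ (t : ℕ))]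
  congr 1
  have : univ.filter (fun t : Fin n => ¬ 3 ≤ (t : ℕ)) = {0, 1, 2} := by
    ext i
    simp only [Finset.mem_filter, Finset.mem_univ, true_and, Finset.mem_insert,
      Finset.mem_singleton]
    constructor
    · intro h
      rcases fin_cases_three hn i with h' | h' | h' | h' <;> tauto
    · intro h h'
      have := ne_of_three_le hn h'
      tauto
  rw [this, Finset.sum_insert (by simp [h01, h02]), Finset.sum_insert (by simp [h12]),
    Finset.sum_singleton, add_assoc]

/-- A permutation commuting with the 3-cycle restricts to a power of it on the first three
indices. -/
theorem apply_of_commute (hn : 4 ≤ n) {σ : Equiv.Perm (Fin n)} (hσ : σ * cyc n = cyc n * σ) :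
    (σ 0 = 0 ∧ σ 1 = 1 ∧ σ 2 = 2) ∨ (σ 0 = 1 ∧ σ 1 = 2 ∧ σ 2 = 0) ∨
      (σ 0 = 2 ∧ σ 1 = 0 ∧ σ 2 = 1) := by
  have hc : ∀ i, σ (cyc n i) = cyc n (σ i) := fun i => DFunLike.congr_fun hσ i
  have h1 := hc 0
  have h2 := hc 1
  rw [cyc_zero hn] at h1
  rw [cyc_one] at h2
  rcases fin_cases_three hn (σ 0) with h | h | h | h
  · rw [h, cyc_zero hn] at h1
    rw [h1, cyc_one] at h2
    exact Or.inl ⟨h, h1, h2⟩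
  · rw [h, cyc_one] at h1
    rw [h1, cyc_two hn] at h2
    exact Or.inr (Or.inl ⟨h, h1, h2⟩)
  · rw [h, cyc_two hn] at h1
    rw [h1, cyc_zero hn] at h2
    exact Or.inr (Or.inr ⟨h, h1, h2⟩)
  · rw [cyc_of_three_le hn h] at h1
    exact absurd (σ.injective h1).symm (zero_one_two_ne hn).1

theorem three_le_apply_of_commute (hn : 4 ≤ n) {σ : Equiv.Perm (Fin n)}
    (hσ : σ * cyc n = cyc n * σ) {i : Fin n} (hi : 3 ≤ (i : ℕ)) : 3 ≤ (σ i : ℕ) := by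
  apply three_le_of_cyc_eq hn
  rw [← Equiv.Perm.mul_apply, ← hσ, Equiv.Perm.mul_apply, cyc_of_three_le hn hi]

theorem mulVec_cyc_eq_iff (hn : 4 ≤ n) (c : Fin n → ℂ) :
    (permMat (cyc n)).mulVec c = c ↔ c 0 = c 1 ∧ c 1 = c 2 := by
  have key : (permMat (cyc n)).mulVec c = c ↔ ∀ i, c i = c (cyc n i) := by
    constructor
    · intro h i
      simpa [permMat_mulVec] using congrFun h (cyc n i)
    · intro h
      ext i
      simpa [permMat_mulVec] using h ((cyc n).symm i)
  rw [key]
  constructor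
  · intro h
    exact ⟨by simpa [cyc_zero hn] using h 0, by simpa [cyc_one] using h 1⟩
  · rintro ⟨h1, h2⟩ i
    rcases fin_cases_three hn i with rfl | rfl | rfl | h
    · rw [cyc_zero hn, h1]
    · rw [cyc_one, h2]
    · rw [cyc_two hn, h1, h2]
    · rw [cyc_of_three_le hn h]

theorem mem_fixedSpace_iff (hn : 4 ≤ n) (u : EuclideanSpace ℂ (Fin n)) :
    u ∈ fixedSpace (permMat (cyc n)) ↔ u 0 = u 1 ∧ u 1 = u 2 := by
  rw [← mulVec_cyc_eq_iff hn, fixedSpace, LinearMap.mem_ker, LinearMap.sub_apply,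
    LinearMap.id_apply, sub_eq_zero]
  exact (WithLp.ofLp_injective 2).eq_iff.symm

theorem mem_fixedSpace_orthogonal_iff (hn : 4 ≤ n) (x : EuclideanSpace ℂ (Fin n)) :
    x ∈ (fixedSpace (permMat (cyc n)))ᗮ ↔
      x 0 + x 1 + x 2 = 0 ∧ ∀ i : Fin n, 3 ≤ (i : ℕ) → x i = 0 := by
  rw [Submodule.mem_orthogonal]
  simp only [PiLp.inner_apply, RCLike.inner_apply, mem_fixedSpace_iff hn]
  constructor
  · intro h
    constructor
    · have := h (WithLp.toLp 2 fun i => if i = 0 ∨ i = 1 ∨ i = 2 then 1 else 0) (by simp)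
      rw [sum_fin_eq_three_add hn, Finset.sum_eq_zero] at this
      · simpa using this
      · intro i hi
        simp [ne_of_three_le hn (Finset.mem_filter.1 hi).2]
    · intro i hi
      obtain ⟨h0, h1, h2⟩ := ne_of_three_le hn hi
      have := h (WithLp.toLp 2 (Pi.single i 1)) (by
        simp [h0.symm, h1.symm, h2.symm])
      rw [Finset.sum_eq_single i] at this
      · simpa using this
      · intro j _ hj
        simp [hj]
      · simp
  · rintro ⟨h0, hx⟩ u ⟨hu1, hu2⟩
    rw [sum_fin_eq_three_add hn, Finset.sum_eq_zero, hu1, hu2, ← add_mul, ← add_mul, h0]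
    · simp
    · intro i hi
      simp [hx i (Finset.mem_filter.1 hi).2]

/-- Coordinates on the orthogonal complement of the fixed space of the 3-cycle. -/
def orthogonalCoords (hn : 4 ≤ n) :
    ↥(fixedSpace (permMat (cyc n)))ᗮ ≃ₗ[ℂ] (Fin 2 → ℂ) where
  toFun x := ![x.1 0, x.1 1]
  map_add' x y := by ext i; fin_cases i <;> simp
  map_smul' c x := by ext i; fin_cases i <;> simp
  invFun a := ⟨WithLp.toLp 2 fun i => if i = 0 then a 0 else if i = 1 then a 1 else
      if i = 2 then - a 0 - a 1 else 0, by
    obtain ⟨h01, h02, h12⟩ := zero_one_two_ne hn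
    rw [mem_fixedSpace_orthogonal_iff hn]
    constructor
    · simp only [if_true, if_neg h01.symm, if_neg h02.symm, if_neg h12.symm]
      ring
    · intro i hi
      obtain ⟨h0, h1, h2⟩ := ne_of_three_le hn hi
      simp [h0, h1, h2]⟩
  left_inv x := by
    obtain ⟨x, hx⟩ := x
    obtain ⟨h01, h02, h12⟩ := zero_one_two_ne hn
    obtain ⟨hs, ht⟩ := (mem_fixedSpace_orthogonal_iff hn x).1 hx
    ext i
    rcases fin_cases_three hn i with rfl | rfl | rfl | h
    · simp
    · simp [h01.symm]
    · simp only [if_neg h02.symm, if_neg h12.symm, if_true, Matrix.cons_val_zero,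
        Matrix.cons_val_one]
      linear_combination -hs
    · obtain ⟨h0, h1, h2⟩ := ne_of_three_le hn h
      simp [h0, h1, h2, ht i h]
  right_inv a := by
    obtain ⟨h01, h02, h12⟩ := zero_one_two_ne hn
    ext i
    fin_cases i
    · simp
    · simp [h01.symm]

theorem chi_eq_one (hn : 4 ≤ n) {σ : Equiv.Perm (Fin n)} (hσ : σ * cyc n = cyc n * σ) :
    chi (permMat (cyc n)) (permMat σ) = 1 := by
  obtain ⟨h01, h02, h12⟩ := zero_one_two_ne hn
  have hap : ∀ (x : EuclideanSpace ℂ (Fin n)) i,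
      (Matrix.toEuclideanLin (permMat σ) x) i = x (σ.symm i) :=
    fun x i => permMat_mulVec σ _ i
  have hσ' : σ.symm * cyc n = cyc n * σ.symm := (show Commute σ (cyc n) from hσ).inv_left
  have hcase := apply_of_commute hn hσ'
  have hinv : ∀ x ∈ (fixedSpace (permMat (cyc n)))ᗮ,
      Matrix.toEuclideanLin (permMat σ) x ∈ (fixedSpace (permMat (cyc n)))ᗮ := by
    intro x hx
    rw [mem_fixedSpace_orthogonal_iff hn] at hx ⊢
    simp only [hap]
    refine ⟨?_, fun i hi => hx.2 _ (three_le_apply_of_commute hn hσ' hi)⟩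
    rcases hcase with ⟨a, b, c⟩ | ⟨a, b, c⟩ | ⟨a, b, c⟩ <;> rw [a, b, c] <;>
      linear_combination hx.1
  rw [chi, detOn, dif_pos hinv, ← LinearMap.det_conj _ (orthogonalCoords hn)]
  have hdet : ∀ M : Matrix (Fin 2) (Fin 2) ℂ, M.det = 1 →
      (∀ a, orthogonalCoords hn (((Matrix.toEuclideanLin (permMat σ)).restrict hinv)
        ((orthogonalCoords hn).symm a)) = M.mulVec a) →
      LinearMap.det ((orthogonalCoords hn : _ →ₗ[ℂ] (Fin 2 → ℂ)) ∘ₗ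
        ((Matrix.toEuclideanLin (permMat σ)).restrict hinv) ∘ₗ
        ((orthogonalCoords hn).symm : (Fin 2 → ℂ) →ₗ[ℂ] _)) = 1 := by
    intro M hM h
    rw [← hM, ← LinearMap.det_toLin']
    congr 1
    exact LinearMap.ext h
  have hcoord : ∀ a, orthogonalCoords hn (((Matrix.toEuclideanLin (permMat σ)).restrict hinv)
        ((orthogonalCoords hn).symm a)) =
      ![((orthogonalCoords hn).symm a).1 (σ.symm 0),
        ((orthogonalCoords hn).symm a).1 (σ.symm 1)] := by
    intro a
    rw [← hap, ← hap]
    rfl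
  rcases hcase with ⟨a, b, c⟩ | ⟨a, b, c⟩ | ⟨a, b, c⟩
  · refine hdet !![1, 0; 0, 1] (by simp [Matrix.det_fin_two]) fun v => ?_
    rw [hcoord, a, b]
    ext i
    fin_cases i <;> simp [orthogonalCoords, h01.symm, Matrix.mulVec, dotProduct]
  · refine hdet !![0, 1; -1, -1] (by simp [Matrix.det_fin_two]) fun v => ?_
    rw [hcoord, a, b]
    ext i
    fin_cases i <;> simp [orthogonalCoords, h01.symm, h02.symm, h12.symm, Matrix.mulVec,
      dotProduct, sub_eq_add_neg]
  · refine hdet !![-1, -1; 1, 0] (by simp [Matrix.det_fin_two]) fun v => ?_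
    rw [hcoord, a, b]
    ext i
    fin_cases i <;> simp [orthogonalCoords, h02.symm, h12.symm, Matrix.mulVec,
      dotProduct, sub_eq_add_neg]

theorem SVg_eq_adjoin (hn : 4 ≤ n) :
    SVg (permMat (cyc n)) = Algebra.adjoin ℂ
      (insert (X (0 : Fin n) + X 1 + X 2) (X '' {t : Fin n | 3 ≤ (t : ℕ)})) := by
  apply le_antisymm
  · refine Algebra.adjoin_le ?_
    rintro _ ⟨c, hc, rfl⟩
    obtain ⟨h1, h2⟩ := (mulVec_cyc_eq_iff hn c).1 hc
    rw [sum_fin_eq_three_add hn, h1, h2, ← mul_add, ← mul_add]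
    refine add_mem (mul_mem (Subalgebra.algebraMap_mem _ _)
      (Algebra.subset_adjoin (Set.mem_insert _ _))) (sum_mem fun i hi => ?_)
    exact mul_mem (Subalgebra.algebraMap_mem _ _)
      (Algebra.subset_adjoin (Set.mem_insert_of_mem _ ⟨i, (Finset.mem_filter.1 hi).2, rfl⟩))
  · refine Algebra.adjoin_mono ?_
    rintro _ (rfl | ⟨t, ht, rfl⟩)
    · refine ⟨fun i => if i = 0 ∨ i = 1 ∨ i = 2 then 1 else 0, ?_, ?_⟩
      · rw [mulVec_cyc_eq_iff hn]
        simp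
      · rw [sum_fin_eq_three_add hn, Finset.sum_eq_zero]
        · simp
        · intro i hi
          simp [ne_of_three_le hn (Finset.mem_filter.1 hi).2]
    · obtain ⟨h0, h1, h2⟩ := ne_of_three_le hn ht
      refine ⟨Pi.single t 1, ?_, ?_⟩
      · rw [mulVec_cyc_eq_iff hn]
        simp [h0.symm, h1.symm, h2.symm]
      · simp [Pi.single_apply, apply_ite, ite_mul]

end ThreeCycle

/-- If `φ p` is unchanged under permuting the variables of `p`, then `φ p` is the image of a
symmetric polynomial, hence of a polynomial in the elementary symmetric polynomials. -/
theorem exists_eq_apply_aeval_esymm {R A τ : Type*} [CommRing R] [CommRing A] [Algebra R A]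
    [Algebra ℚ R] [Fintype τ] (φ : MvPolynomial τ R →ₐ[R] A) (p : MvPolynomial τ R)
    (hp : ∀ σ : Equiv.Perm τ, φ (rename σ p) = φ p) :
    ∃ q : MvPolynomial (Fin (Fintype.card τ)) R,
      φ p = φ (aeval (fun i : Fin (Fintype.card τ) => esymm τ R (i + 1)) q) := by
  set c : R := algebraMap ℚ R (Fintype.card (Equiv.Perm τ) : ℚ)⁻¹ with hc
  have hsymm : (C c * ∑ σ : Equiv.Perm τ, rename σ p).IsSymmetric := by
    intro π
    rw [map_mul, rename_C, map_sum]
    congr 1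
    simp only [rename_rename]
    exact Fintype.sum_equiv (Equiv.mulLeft π) _ _ fun σ => rfl
  obtain ⟨q, hq⟩ := esymmAlgHom_surjective R le_rfl
    (⟨_, hsymm⟩ : symmetricSubalgebra τ R)
  refine ⟨q, ?_⟩
  rw [← esymmAlgHom_apply, hq]
  have hcard : c * (Fintype.card (Equiv.Perm τ) : R) = 1 := by
    rw [hc, ← map_natCast (algebraMap ℚ R), ← map_mul, inv_mul_cancel₀, map_one]
    exact_mod_cast Fintype.card_ne_zero
  rw [map_mul, map_sum, Finset.sum_congr rfl fun σ _ => hp σ, Finset.sum_const,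
    Finset.card_univ, nsmul_eq_mul, ← mul_assoc, ← algebraMap_eq, AlgHom.commutes,
    ← map_natCast (algebraMap R A), ← map_mul, hcard, map_one, one_mul]

theorem sum_powersetCard_eq_aeval_esymm {n : ℕ} (R : Subalgebra ℂ (MvPolynomial (Fin n) ℂ))
    (i : ℕ) :
    ∑ s ∈ Finset.powersetCard i (univ.filter fun t : Fin n => 3 ≤ (t : ℕ)),
        ∏ t ∈ s, (X t : MvPolynomial (Fin n) ℂ) =
      aeval (fun t : {t : Fin n // 3 ≤ (t : ℕ)} => (X (t : Fin n) : MvPolynomial (Fin n) ℂ))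
        (esymm {t : Fin n // 3 ≤ (t : ℕ)} R i) := by
  rw [← Finset.univ_map_subtype, Finset.powersetCard_map, Finset.sum_map, esymm, map_sum]
  refine Finset.sum_congr rfl fun s _ => ?_
  simp [Finset.mapEmbedding_apply]

theorem mem_adjoin_of_invariant {n : ℕ} [NeZero n] (hn : 4 ≤ n) {f : MvPolynomial (Fin n) ℂ}
    (hf : f ∈ SVg (permMat (cyc n)))
    (hinv : ∀ σ : Equiv.Perm (Fin n), σ * cyc n = cyc n * σ → act (permMat σ) f = f) :
    f ∈ Algebra.adjoin ℂ (insert (X (0 : Fin n) + X 1 + X 2)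
      ((fun i => ∑ s ∈ Finset.powersetCard i (univ.filter fun t : Fin n => 3 ≤ (t : ℕ)),
        ∏ t ∈ s, (X t : MvPolynomial (Fin n) ℂ)) '' Set.Icc 1 (n - 3))) := by
  set S := Algebra.adjoin ℂ (insert (X (0 : Fin n) + X 1 + X 2)
      ((fun i => ∑ s ∈ Finset.powersetCard i (univ.filter fun t : Fin n => 3 ≤ (t : ℕ)),
        ∏ t ∈ s, (X t : MvPolynomial (Fin n) ℂ)) '' Set.Icc 1 (n - 3)))
  let R : Subalgebra ℂ (MvPolynomial (Fin n) ℂ) := Algebra.adjoin ℂ {X (0 : Fin n) + X 1 + X 2}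
  let φ : MvPolynomial {t : Fin n // 3 ≤ (t : ℕ)} R →ₐ[R] MvPolynomial (Fin n) ℂ :=
    aeval fun t => X (t : Fin n)
  have hφ : ∀ r : R, φ (C r) = r := fun r => by simp [φ]
  obtain ⟨p, rfl⟩ : f ∈ (φ.restrictScalars ℂ).range := by
    rw [SVg_eq_adjoin hn] at hf
    refine (Algebra.adjoin_le ?_ : _ ≤ (φ.restrictScalars ℂ).range) hf
    rintro _ (rfl | ⟨t, ht, rfl⟩)
    · exact ⟨C ⟨_, Algebra.subset_adjoin rfl⟩, hφ _⟩
    · exact ⟨X ⟨t, ht⟩, by simp [φ]⟩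
  have hp : ∀ σ : Equiv.Perm {t : Fin n // 3 ≤ (t : ℕ)}, φ (rename σ p) = φ p := by
    intro σ
    obtain ⟨v0, v1, v2⟩ := val_zero_one_two hn
    have e0 : Equiv.Perm.ofSubtype σ 0 = 0 :=
      Equiv.Perm.ofSubtype_apply_of_not_mem σ (by omega)
    have e1 : Equiv.Perm.ofSubtype σ 1 = 1 :=
      Equiv.Perm.ofSubtype_apply_of_not_mem σ (by omega)
    have e2 : Equiv.Perm.ofSubtype σ 2 = 2 :=
      Equiv.Perm.ofSubtype_apply_of_not_mem σ (by omega)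
    have hcomm : Equiv.Perm.ofSubtype σ * cyc n = cyc n * Equiv.Perm.ofSubtype σ := by
      ext1 i
      simp only [Equiv.Perm.mul_apply]
      rcases fin_cases_three hn i with rfl | rfl | rfl | h
      · rw [cyc_zero hn, e0, e1, cyc_zero hn]
      · rw [cyc_one, e1, e2, cyc_one]
      · rw [cyc_two hn, e0, e2, cyc_two hn]
      · rw [cyc_of_three_le hn h, cyc_of_three_le hn
          ((Equiv.Perm.ofSubtype_apply_mem_iff_mem σ i).2 h)]
    have hR : ∀ r ∈ R, act (permMat (Equiv.Perm.ofSubtype σ)) r = r := by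
      intro r hr
      refine (Algebra.adjoin_le ?_ : R ≤ AlgHom.equalizer
        (act (permMat (Equiv.Perm.ofSubtype σ))) (AlgHom.id ℂ _)) hr
      rintro _ rfl
      simp [act_permMat_X, e0, e1, e2]
    refine Eq.trans ?_ (hinv _ hcomm)
    change (φ.toRingHom.comp (rename σ : _ →ₐ[R] _).toRingHom) p =
      ((act (permMat (Equiv.Perm.ofSubtype σ))).toRingHom.comp φ.toRingHom) p
    congr 1
    refine MvPolynomial.ringHom_ext (fun r => ?_) fun t => ?_
    · simp [hφ, hR r r.2]
    · simp [φ, act_permMat_X, Equiv.Perm.ofSubtype_apply_coe]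
  obtain ⟨q, hq⟩ := exists_eq_apply_aeval_esymm φ p hp
  change φ p ∈ S
  rw [hq]
  clear hq
  induction q using MvPolynomial.induction_on with
  | C r =>
    rw [← algebraMap_eq, AlgHom.commutes, algebraMap_eq, hφ]
    refine Algebra.adjoin_mono ?_ r.2
    simp
  | add p q hp hq =>
    rw [map_add, map_add]
    exact add_mem hp hq
  | mul_X p i hp =>
    rw [map_mul, map_mul, aeval_X]
    refine mul_mem hp (Algebra.subset_adjoin (Set.mem_insert_of_mem _ ⟨i + 1, ?_, ?_⟩))
    · have hcard : Fintype.card {t : Fin n // 3 ≤ (t : ℕ)} = n - 3 := by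
        have := sum_fin_eq_three_add hn fun _ => 1
        simp only [Finset.sum_const, Finset.card_univ, Fintype.card_fin, smul_eq_mul,
          mul_one] at this
        rw [Fintype.card_subtype]
        omega
      exact ⟨by omega, by have := i.2; omega⟩
    · exact sum_powersetCard_eq_aeval_esymm R _

theorem act_eq_self_of_mem_adjoin {n : ℕ} [NeZero n] (hn : 4 ≤ n) {f : MvPolynomial (Fin n) ℂ}
    (hf : f ∈ Algebra.adjoin ℂ (insert (X (0 : Fin n) + X 1 + X 2)
      ((fun i => ∑ s ∈ Finset.powersetCard i (univ.filter fun t : Fin n => 3 ≤ (t : ℕ)),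
        ∏ t ∈ s, (X t : MvPolynomial (Fin n) ℂ)) '' Set.Icc 1 (n - 3))))
    {σ : Equiv.Perm (Fin n)} (hσ : σ * cyc n = cyc n * σ) : act (permMat σ) f = f := by
  refine (Algebra.adjoin_le ?_ : _ ≤ AlgHom.equalizer (act (permMat σ)) (AlgHom.id ℂ _)) hf
  rintro _ (rfl | ⟨i, -, rfl⟩)
  · simp only [SetLike.mem_coe, AlgHom.mem_equalizer, map_add, act_permMat_X, AlgHom.id_apply]
    rcases apply_of_commute hn hσ with ⟨a, b, c⟩ | ⟨a, b, c⟩ | ⟨a, b, c⟩ <;> rw [a, b, c] <;> ring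
  · have hmap : (univ.filter fun t : Fin n => 3 ≤ (t : ℕ)).map σ.toEmbedding =
        univ.filter fun t : Fin n => 3 ≤ (t : ℕ) := by
      refine Finset.eq_of_subset_of_card_le (fun j hj => ?_) (by rw [Finset.card_map])
      obtain ⟨k, hk, rfl⟩ := Finset.mem_map.1 hj
      simp only [Finset.mem_filter, Finset.mem_univ, true_and] at hk ⊢
      exact three_le_apply_of_commute hn hσ hk
    simp only [SetLike.mem_coe, AlgHom.mem_equalizer, AlgHom.id_apply, map_sum, map_prod,
      act_permMat_X]
    conv_rhs => rw [← hmap, Finset.powersetCard_map, Finset.sum_map]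
    refine Finset.sum_congr rfl fun s _ => ?_
    simp [Finset.mapEmbedding_apply]

theorem mem_SVg_of_mem_adjoin {n : ℕ} [NeZero n] (hn : 4 ≤ n) {f : MvPolynomial (Fin n) ℂ}
    (hf : f ∈ Algebra.adjoin ℂ (insert (X (0 : Fin n) + X 1 + X 2)
      ((fun i => ∑ s ∈ Finset.powersetCard i (univ.filter fun t : Fin n => 3 ≤ (t : ℕ)),
        ∏ t ∈ s, (X t : MvPolynomial (Fin n) ℂ)) '' Set.Icc 1 (n - 3)))) :
    f ∈ SVg (permMat (cyc n)) := by
  rw [SVg_eq_adjoin hn]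
  refine Algebra.adjoin_le ?_ hf
  rintro _ (rfl | ⟨i, -, rfl⟩)
  · exact Algebra.subset_adjoin (Set.mem_insert _ _)
  · refine sum_mem fun s hs => prod_mem fun t ht => Algebra.subset_adjoin
      (Set.mem_insert_of_mem _ ⟨t, ?_, rfl⟩)
    exact (Finset.mem_filter.1 ((Finset.mem_powersetCard.1 hs).1 ht)).2

/-- Let `G = 𝔖_n = G(1,1,n)` (permutation matrices) act on `V = ℂⁿ`
with `n ≥ 4`, and let `g = (1,2,3)`.  Then the `χ_g`-semi-invariants equal the
`Z(g)`-invariants and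
`S(V^g)^{χ_g} = S(V^g)^{Z(g)} = ℂ[f₀, f₁, …, f_{n−3}]`,
where `f₀ = v₁+v₂+v₃` and `f_i = e_i(v₄,…,v_n)` for `1 ≤ i ≤ n−3`. -/
theorem semiinvariants_of_three_cycle_in_symmetric_group
    (n : ℕ) [NeZero n] (hn : 4 ≤ n) :
    ({f : MvPolynomial (Fin n) ℂ |
        f ∈ SVg (g123 n) ∧
          ∀ h ∈ Zg 1 1 n (g123 n), act h f = chi (g123 n) h • f}
      = {f | f ∈ SVg (g123 n) ∧ ∀ h ∈ Zg 1 1 n (g123 n), act h f = f})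
    ∧ {f : MvPolynomial (Fin n) ℂ |
        f ∈ SVg (g123 n) ∧ ∀ h ∈ Zg 1 1 n (g123 n), act h f = f}
      = ↑(Algebra.adjoin ℂ
          (insert (X (0 : Fin n) + X 1 + X 2)
            ((fun i => ∑ s ∈ Finset.powersetCard i
                  (Finset.univ.filter fun t : Fin n => 3 ≤ (t : ℕ)),
                ∏ t ∈ s, (X t : MvPolynomial (Fin n) ℂ)) '' Set.Icc 1 (n - 3)))) := by
  rw [g123_eq_permMat]
  constructor
  · ext f
    refine and_congr_right fun _ => forall₂_congr fun h hh => ?_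
    obtain ⟨σ, hσ, rfl⟩ := (mem_Zg_iff _ _).1 hh
    rw [chi_eq_one hn hσ, one_smul]
  · ext f
    constructor
    · rintro ⟨hf, hinv⟩
      exact mem_adjoin_of_invariant hn hf fun σ hσ => hinv _ ((mem_Zg_iff _ _).2 ⟨σ, hσ, rfl⟩)
    · intro hf
      refine ⟨mem_SVg_of_mem_adjoin hn hf, fun h hh => ?_⟩
      obtain ⟨σ, hσ, rfl⟩ := (mem_Zg_iff _ _).1 hh
      exact act_eq_self_of_mem_adjoin hn hf hσ

end
end
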